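/- Let W and W' be real random variables on the same probability space with the same distribution, and let D := W' − W. Then for any real numbers a ≤ b and any K > 0, E(D²·1[a ≤ W ≤ b, |D| ≤ K]) ≤ (b − a + 2K)·E|E(D|W)|. -/

import Mathlib

open MeasureTheory Real

/-- Truncation of a real number to the interval `[-h, h]`. -/
def clip (h x : ℝ) : ℝ := max (-h) (min x h)

lemma measurable_clip (h : ℝ) : Measurable (clip h) := by
  unfold clip; fun_prop

lemma abs_clip_le {h : ℝ} (hh : 0 ≤ h) (x : ℝ) : |clip h x| ≤ h := by
  unfold clip
  rw [abs_le]
  exact ⟨le_max_left _ _, max_le (by linarith) (min_le_right _ _)⟩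

lemma clip_eq_self {h x : ℝ} (hx : |x| ≤ h) : clip h x = x := by
  unfold clip
  rw [abs_le] at hx
  rw [min_eq_left hx.2, max_eq_right hx.1]

lemma abs_clip_sub_clip_le (h x y : ℝ) : |clip h x - clip h y| ≤ |x - y| := by
  unfold clip
  rw [max_comm (-h), max_comm (-h)]
  refine (abs_max_sub_max_le_abs _ _ _).trans ?_
  refine (abs_min_sub_min_le_max _ _ _ _).trans ?_
  simp

/-- The Huber function, an antiderivative of `clip h`. -/
noncomputable def huber (h x : ℝ) : ℝ := clip h x * x - clip h x ^ 2 / 2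

lemma measurable_huber (h : ℝ) : Measurable (huber h) := by
  have := measurable_clip h
  unfold huber; fun_prop

lemma le_huber {h t : ℝ} (ht : |t| ≤ h) (x : ℝ) : t * x - t ^ 2 / 2 ≤ huber h x := by
  unfold huber clip
  rw [abs_le] at ht
  rcases le_total x h with h1 | h1
  · rw [min_eq_left h1]
    rcases le_total (-h) x with h2 | h2
    · rw [max_eq_right h2]; nlinarith [sq_nonneg (t - x)]
    · rw [max_eq_left h2]; nlinarith [mul_nonneg (sub_nonneg.2 h2) (by linarith : 0 ≤ t + h)]
  · rw [min_eq_right h1, max_eq_right (by linarith)]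
    nlinarith [mul_nonneg (sub_nonneg.2 h1) (by linarith : 0 ≤ h - t)]

lemma clip_mul_sub_le_huber_sub {h : ℝ} (hh : 0 ≤ h) (x y : ℝ) :
    clip h x * (y - x) ≤ huber h y - huber h x := by
  have := le_huber (abs_clip_le hh x) y
  simp only [huber] at this ⊢
  linarith

lemma abs_huber_sub_huber_le {h : ℝ} (hh : 0 ≤ h) (x y : ℝ) :
    |huber h y - huber h x| ≤ h * |y - x| := by
  have key (u v : ℝ) : huber h v - huber h u ≤ h * |v - u| := by
    have h1 := clip_mul_sub_le_huber_sub hh v u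
    have h2 : clip h v * (v - u) ≤ h * |v - u| :=
      (le_abs_self _).trans (by rw [abs_mul]; gcongr; exact abs_clip_le hh v)
    linarith
  rw [abs_le]
  have := key y x
  rw [abs_sub_comm] at this
  exact ⟨by linarith, key x y⟩

/-- Two real random variables with the same law whose difference is integrable have a centred
difference, even if neither is integrable. -/
lemma integral_sub_eq_zero_of_map_eq {Ω : Type*} [MeasurableSpace Ω] {μ : Measure Ω}
    [IsFiniteMeasure μ] {X Y : Ω → ℝ} (hX : Measurable X) (hY : Measurable Y)
    (h : μ.map X = μ.map Y) (hint : Integrable (fun ω => X ω - Y ω) μ) :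
    ∫ ω, (X ω - Y ω) ∂μ = 0 := by
  have hzero (n : ℕ) : ∫ ω, (clip n (X ω) - clip n (Y ω)) ∂μ = 0 := by
    have hi {Z : Ω → ℝ} (hZ : Measurable Z) : Integrable (fun ω => clip n (Z ω)) μ :=
      Integrable.of_bound ((measurable_clip n).comp hZ).aestronglyMeasurable n
        (ae_of_all _ fun ω => abs_clip_le n.cast_nonneg _)
    rw [integral_sub (hi hX) (hi hY),
      ← integral_map (f := clip n) hX.aemeasurable (measurable_clip n).aestronglyMeasurable,
      ← integral_map (f := clip n) hY.aemeasurable (measurable_clip n).aestronglyMeasurable,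
      h, sub_self]
  have hlim (x : ℝ) : Filter.Tendsto (fun n : ℕ => clip n x) Filter.atTop (nhds x) := by
    refine tendsto_const_nhds.congr' ?_
    filter_upwards [Filter.eventually_ge_atTop ⌈|x|⌉₊] with n hn
    exact (clip_eq_self (Nat.ceil_le.1 hn)).symm
  refine tendsto_nhds_unique (tendsto_integral_of_dominated_convergence
    (F := fun (n : ℕ) ω => clip n (X ω) - clip n (Y ω)) (fun ω => |X ω - Y ω|) (fun n => ?_)
    hint.abs (fun n => ae_of_all _ fun ω => abs_clip_sub_clip_le _ _ _)
    (ae_of_all _ fun ω => (hlim _).sub (hlim _))) ?_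
  · exact (((measurable_clip n).comp hX).sub ((measurable_clip n).comp hY)).aestronglyMeasurable
  · simp only [hzero]
    exact tendsto_const_nhds

/-- For `g` bounded by `C` and `m`-measurable, `|E(g D)| ≤ C E|E(D|m)|`. -/
lemma abs_integral_mul_le_mul_integral_abs_condExp {Ω : Type*} {m m0 : MeasurableSpace Ω}
    {μ : Measure Ω} [IsFiniteMeasure μ] (hm : m ≤ m0) {g D : Ω → ℝ} {C : ℝ}
    (hg : StronglyMeasurable[m] g) (hC : ∀ ω, |g ω| ≤ C) (hD : Integrable D μ) :
    |∫ ω, g ω * D ω ∂μ| ≤ C * ∫ ω, |(μ[D | m]) ω| ∂μ := by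
  have hgD : Integrable (g * D) μ :=
    hD.bdd_mul (hg.mono hm).aestronglyMeasurable (ae_of_all _ hC)
  have heq : ∫ ω, g ω * D ω ∂μ = ∫ ω, g ω * (μ[D | m]) ω ∂μ := by
    calc ∫ ω, g ω * D ω ∂μ = ∫ ω, (μ[g * D | m]) ω ∂μ := (integral_condExp hm).symm
      _ = _ := integral_congr_ae (condExp_mul_of_stronglyMeasurable_left hg hgD hD)
  rw [heq, ← integral_const_mul, ← Real.norm_eq_abs]
  refine norm_integral_le_of_norm_le (integrable_condExp.abs.const_mul C) (ae_of_all _ fun ω => ?_)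
  rw [norm_mul, Real.norm_eq_abs, Real.norm_eq_abs]
  gcongr
  exact hC ω

/-- Lemma 2.4 (key). -/
theorem key_lemma
    {Ω : Type*} [MeasurableSpace Ω] {μ : Measure Ω} [IsProbabilityMeasure μ]
    (W W' : Ω → ℝ) (hW : Measurable W) (hW' : Measurable W')
    (hdist : μ.map W = μ.map W')
    (D : Ω → ℝ) (hDdef : D = fun ω => W' ω - W ω)
    (hD1 : Integrable D μ)
    (hD2 : Integrable (fun ω => (D ω) ^ 2) μ)
    (a b : ℝ) (hab : a ≤ b) (K : ℝ) (hK : 0 < K) :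
    (∫ ω, (D ω) ^ 2 *
        Set.indicator {ω' | a ≤ W ω' ∧ W ω' ≤ b ∧ |D ω'| ≤ K} (fun _ => (1 : ℝ)) ω ∂μ) ≤
      (b - a + 2 * K) * (∫ ω, |(μ[D | MeasurableSpace.comap W inferInstance]) ω| ∂μ) := by
  have hD (ω : Ω) : D ω = W' ω - W ω := congrFun hDdef ω
  set c := (a + b) / 2 with hc
  set h := (b - a) / 2 + K with hh
  have h0 : 0 ≤ h := by linarith
  set S := {ω' | a ≤ W ω' ∧ W ω' ≤ b ∧ |D ω'| ≤ K} with hS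
  have hF : Measurable fun x => huber h (x - c) :=
    (measurable_huber h).comp (measurable_id.sub_const c)
  have hint : Integrable (fun ω => huber h (W' ω - c) - huber h (W ω - c)) μ := by
    refine (hD1.abs.const_mul h).mono'
      ((hF.comp hW').sub (hF.comp hW)).aestronglyMeasurable (ae_of_all _ fun ω => ?_)
    refine (abs_huber_sub_huber_le h0 _ _).trans_eq ?_
    rw [hD, sub_sub_sub_cancel_right]
  have hzero : ∫ ω, (huber h (W' ω - c) - huber h (W ω - c)) ∂μ = 0 := by
    refine integral_sub_eq_zero_of_map_eq (hF.comp hW') (hF.comp hW) ?_ hint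
    have := congrArg (Measure.map fun x => huber h (x - c)) hdist
    rw [Measure.map_map hF hW, Measure.map_map hF hW'] at this
    exact this.symm
  have hG : Measurable fun x => clip h (x - c) :=
    (measurable_clip h).comp (measurable_id.sub_const c)
  have hgD : Integrable (fun ω => clip h (W ω - c) * D ω) μ :=
    hD1.bdd_mul (hG.comp hW).aestronglyMeasurable (ae_of_all _ fun ω => abs_clip_le h0 _)
  have hpt (ω : Ω) : D ω ^ 2 * S.indicator (fun _ => (1 : ℝ)) ω ≤
      2 * ((huber h (W' ω - c) - huber h (W ω - c)) - clip h (W ω - c) * D ω) := by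
    by_cases hω : ω ∈ S
    · rw [Set.indicator_of_mem hω]
      obtain ⟨h1, h2, h3⟩ := hω
      rw [hD, abs_le] at h3
      have hu : |W ω - c| ≤ h := abs_le.2 ⟨by linarith, by linarith⟩
      have hv : |W' ω - c| ≤ h := abs_le.2 ⟨by linarith [h3.1], by linarith [h3.2]⟩
      simp only [huber, clip_eq_self hu, clip_eq_self hv, hD]
      apply le_of_eq
      ring
    · rw [Set.indicator_of_notMem hω]
      have := clip_mul_sub_le_huber_sub h0 (W ω - c) (W' ω - c)
      rw [sub_sub_sub_cancel_right, ← hD] at this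
      linarith
  have hle := integral_mono_of_nonneg
    (ae_of_all μ fun ω => mul_nonneg (sq_nonneg (D ω))
      (Set.indicator_nonneg (fun _ _ => zero_le_one) ω))
    ((hint.sub hgD).const_mul 2) (ae_of_all μ hpt)
  have hbound := abs_integral_mul_le_mul_integral_abs_condExp (μ := μ) hW.comap_le
    (hG.comp (comap_measurable W)).stronglyMeasurable (fun ω => abs_clip_le h0 (W ω - c)) hD1
  simp only [Pi.sub_apply, Function.comp_apply] at hle hbound
  rw [integral_const_mul, integral_sub hint hgD, hzero] at hle
  have hfac : b - a + 2 * K = 2 * h := by rw [hh]; ring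
  rw [hfac]
  linarith [(abs_le.1 hbound).1]
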